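/- Let r > 0, let q = e^{−π√r}, and let k₁₁ ∈ (0,1) satisfy K(√(1−k₁₁²)) = √r · K(k₁₁). Set k₁₂ = √(1−k₁₁²), k₂₁ = (2 − k₁₁² − 2k₁₂)/k₁₁², and k₂₂ = √(1−k₂₁²). Then for every integer s, ∑_{n∈ℤ} q^{n² + (2s+1)n} = 2^{5/6} · q^{−(2s+1)²/4} · (k₁₁ k₁₂ k₂₁)^{1/6} · k₂₂^{−1/3} · √(K(k₁₁)/π). -/

import Mathlib

open Real

/-- Complete elliptic integral of the first kind. -/
noncomputable def ellK (x : ℝ) : ℝ :=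
  ∫ θ in (0:ℝ)..(π/2), (1 - x ^ 2 * Real.sin θ ^ 2) ^ (-(1:ℝ)/2)

/-- The eta product `η(q) = ∏_{n≥1} (1 - q^n)` (real powers). -/
noncomputable def etaP (q : ℝ) : ℝ := ∏' n : ℕ, (1 - q ^ ((n : ℝ) + 1))

/-- `A(a,p;q) = q^{p/12 - a/2 + a²/(2p)} ∏_{n≥1} (1 - q^{np+a})(1 - q^{np+p-a})`. -/
noncomputable def Afun (a p q : ℝ) : ℝ :=
  q ^ (p / 12 - a / 2 + a ^ 2 / (2 * p)) *
    ∏' n : ℕ, ((1 - q ^ (((n : ℝ) + 1) * p + a)) * (1 - q ^ (((n : ℝ) + 1) * p + p - a)))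

lemma tsum_eq_add_of_bijective_sumElim {α β γ : Type*} {i : α → γ} {j : β → γ}
    (h : Function.Bijective (Sum.elim i j)) {f : γ → ℝ} (hf : Summable f) :
    ∑' c, f c = ∑' a, f (i a) + ∑' b, f (j b) := by
  have hi : Function.Injective i := fun x y hxy => Sum.inl_injective (h.1 (by simpa using hxy))
  have hj : Function.Injective j := fun x y hxy => Sum.inr_injective (h.1 (by simpa using hxy))
  rw [← (Equiv.ofBijective _ h).tsum_eq f]
  exact (HasSum.sum (f := fun x => f (Sum.elim i j x))
    (hf.comp_injective hi).hasSum (hf.comp_injective hj).hasSum).tsum_eq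

lemma bijective_sumElim_even_odd :
    Function.Bijective (Sum.elim (fun n : ℤ => 2 * n) (fun n : ℤ => 2 * n + 1)) := by
  constructor
  · rintro (x | x) (y | y) h <;> simp at h ⊢ <;> omega
  · intro n
    obtain ⟨m, hm | hm⟩ := Int.even_or_odd' n
    · exact ⟨Sum.inl m, hm.symm⟩
    · exact ⟨Sum.inr m, hm.symm⟩

lemma bijective_sumElim_add_sub :
    Function.Bijective (Sum.elim (fun p : ℤ × ℤ => (p.1 + p.2, p.1 - p.2))
      (fun p : ℤ × ℤ => (p.1 + p.2 + 1, p.1 - p.2))) := by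
  constructor
  · rintro (⟨x, x'⟩ | ⟨x, x'⟩) (⟨y, y'⟩ | ⟨y, y'⟩) h <;>
      simp only [Sum.elim_inl, Sum.elim_inr, Prod.mk.injEq, Sum.inl.injEq, Sum.inr.injEq,
        reduceCtorEq] at h ⊢ <;> omega
  · rintro ⟨m, n⟩
    obtain ⟨c, hc | hc⟩ := Int.even_or_odd' (m + n)
    · exact ⟨Sum.inl (c, m - c), by simp; omega⟩
    · exact ⟨Sum.inr (c, m - c - 1), by simp; omega⟩

/-- The theta constant `θ₃` at the nome `exp (-π t)`. -/
noncomputable def theta3 (t : ℝ) : ℝ := ∑' n : ℤ, Real.exp (-π * t * (n : ℝ) ^ 2)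

/-- The theta constant `θ₂` at the nome `exp (-π t)`. -/
noncomputable def theta2 (t : ℝ) : ℝ := ∑' n : ℤ, Real.exp (-π * t * ((n : ℝ) + 1 / 2) ^ 2)

/-- The theta constant `θ₄` at the nome `exp (-π t)`. -/
noncomputable def theta4 (t : ℝ) : ℝ := 2 * theta3 (4 * t) - theta3 t

lemma summable_theta3 {t : ℝ} (ht : 0 < t) :
    Summable fun n : ℤ => Real.exp (-π * t * (n : ℝ) ^ 2) := by
  refine (summable_pow_mul_jacobiTheta₂_term_bound 0 ht 0).congr fun n => ?_
  simp [mul_assoc]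

lemma exp_theta2_eq (t : ℝ) (n : ℤ) :
    Real.exp (-π * t * ((n : ℝ) + 1 / 2) ^ 2) =
      Real.exp (-π * (t / 4) * ((2 * n + 1 : ℤ) : ℝ) ^ 2) := by
  congr 1
  push_cast
  ring

lemma summable_theta2 {t : ℝ} (ht : 0 < t) :
    Summable fun n : ℤ => Real.exp (-π * t * ((n : ℝ) + 1 / 2) ^ 2) := by
  simp_rw [exp_theta2_eq]
  exact (summable_theta3 (show 0 < t / 4 by positivity)).comp_injective
    (i := fun n : ℤ => 2 * n + 1) fun x y h => by simpa using h

lemma theta3_pos {t : ℝ} (ht : 0 < t) : 0 < theta3 t :=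
  (summable_theta3 ht).tsum_pos (fun _ => (Real.exp_pos _).le) 0 (Real.exp_pos _)

lemma theta2_pos {t : ℝ} (ht : 0 < t) : 0 < theta2 t :=
  (summable_theta2 ht).tsum_pos (fun _ => (Real.exp_pos _).le) 0 (Real.exp_pos _)

lemma theta2_eq {t : ℝ} (ht : 0 < t) : theta2 t = theta3 (t / 4) - theta3 t := by
  have h := tsum_eq_add_of_bijective_sumElim bijective_sumElim_even_odd
    (summable_theta3 (show 0 < t / 4 by positivity))
  simp_rw [← exp_theta2_eq] at h
  have h2 : ∀ n : ℤ, Real.exp (-π * (t / 4) * ((2 * n : ℤ) : ℝ) ^ 2) =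
      Real.exp (-π * t * (n : ℝ) ^ 2) := fun n => by
    congr 1
    push_cast
    ring
  simp_rw [h2] at h
  rw [theta2, theta3, theta3, h]
  ring

lemma tsum_mul_tsum_of_pos {f g : ℤ → ℝ} (hf : Summable f) (hg : Summable g)
    (hf0 : ∀ n, 0 ≤ f n) (hg0 : ∀ n, 0 ≤ g n) :
    (∑' n, f n) * ∑' n, g n = ∑' p : ℤ × ℤ, f p.1 * g p.2 :=
  hf.tsum_mul_tsum hg (hf.mul_of_nonneg hg hf0 hg0)

lemma theta3_sq {t : ℝ} (ht : 0 < t) :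
    theta3 t ^ 2 = theta3 (2 * t) ^ 2 + theta2 (2 * t) ^ 2 := by
  have h3 := summable_theta3 ht
  have h3' := summable_theta3 (show 0 < 2 * t by positivity)
  have h2' := summable_theta2 (show 0 < 2 * t by positivity)
  rw [sq, sq, sq, theta3, theta3, theta2,
    tsum_mul_tsum_of_pos h3 h3 (fun _ => (Real.exp_pos _).le) (fun _ => (Real.exp_pos _).le),
    tsum_mul_tsum_of_pos h3' h3' (fun _ => (Real.exp_pos _).le) (fun _ => (Real.exp_pos _).le),
    tsum_mul_tsum_of_pos h2' h2' (fun _ => (Real.exp_pos _).le) (fun _ => (Real.exp_pos _).le),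
    tsum_eq_add_of_bijective_sumElim bijective_sumElim_add_sub
      (h3.mul_of_nonneg h3 (fun _ => (Real.exp_pos _).le) (fun _ => (Real.exp_pos _).le))]
  congr 1 <;> refine tsum_congr fun p => ?_ <;> rw [← Real.exp_add, ← Real.exp_add] <;>
    congr 1 <;> push_cast <;> ring

lemma theta3_sq_double {t : ℝ} (ht : 0 < t) :
    theta3 (2 * t) ^ 2 =
      2 * theta3 (4 * t) ^ 2 + theta3 t ^ 2 - 2 * theta3 t * theta3 (4 * t) := by
  have h := theta3_sq (show 0 < 2 * t by positivity)
  rw [theta2_eq (by positivity), show 2 * (2 * t) / 4 = t by ring,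
    show 2 * (2 * t) = 4 * t by ring] at h
  linear_combination h

lemma theta3_sq_add_theta4_sq {t : ℝ} (ht : 0 < t) :
    (theta3 t ^ 2 + theta4 t ^ 2) / 2 = theta3 (2 * t) ^ 2 := by
  rw [theta4]
  linear_combination -theta3_sq_double ht

lemma theta3_mul_theta4 {t : ℝ} (ht : 0 < t) :
    theta3 t * theta4 t = theta4 (2 * t) ^ 2 := by
  have h1 := theta3_sq_double ht
  have h2 := theta3_sq_double (show 0 < 2 * t by positivity)
  rw [show 2 * (2 * t) = 4 * t by ring] at h2
  rw [theta4, theta4]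
  linear_combination 2 * h2 + h1

lemma theta3_pow_four {t : ℝ} (ht : 0 < t) :
    theta2 t ^ 4 + theta4 t ^ 4 = theta3 t ^ 4 := by
  have h1 := theta3_sq_double ht
  have h2 := theta3_sq_double (show 0 < t / 2 by positivity)
  have h3 := theta3_sq_double (show 0 < t / 4 by positivity)
  rw [show 2 * (t / 2) = t by ring, show 4 * (t / 2) = 2 * t by ring] at h2
  rw [show 2 * (t / 4) = t / 2 by ring, show 4 * (t / 4) = t by ring] at h3
  have e2 : theta2 t ^ 2 = 2 * theta3 (2 * t) * (theta3 (t / 2) - theta3 (2 * t)) := by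
    rw [theta2_eq ht]
    linear_combination -h3 - h2
  have e4 : theta4 t ^ 2 = theta3 (t / 2) * (2 * theta3 (2 * t) - theta3 (t / 2)) := by
    rw [theta4]
    linear_combination -2 * h1 - h2
  rw [show theta2 t ^ 4 = (theta2 t ^ 2) ^ 2 by ring,
    show theta4 t ^ 4 = (theta4 t ^ 2) ^ 2 by ring,
    show theta3 t ^ 4 = (theta3 t ^ 2) ^ 2 by ring, e2, e4, h2]
  ring

lemma theta3_inv {t : ℝ} (ht : 0 < t) : theta3 t⁻¹ = √t * theta3 t := by
  have h := Real.tsum_exp_neg_mul_int_sq ht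
  rw [← Real.sqrt_eq_rpow, div_eq_mul_inv (-π) t] at h
  rw [theta3, theta3, h]
  have := Real.sqrt_pos.2 ht
  field_simp

lemma theta2_inv {t : ℝ} (ht : 0 < t) : theta2 t⁻¹ = √t * theta4 t := by
  rw [theta2_eq (by positivity), theta4, show t⁻¹ / 4 = (4 * t)⁻¹ by field_simp,
    theta3_inv ht, theta3_inv (by positivity), Real.sqrt_mul (by norm_num),
    show (4 : ℝ) = 2 ^ 2 by norm_num, Real.sqrt_sq (by norm_num)]
  ring

lemma theta4_pos {t : ℝ} (ht : 0 < t) : 0 < theta4 t := by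
  have h := theta2_pos (inv_pos.2 ht)
  rw [theta2_inv ht] at h
  exact pos_of_mul_pos_right h (Real.sqrt_nonneg t)

lemma jacobiTheta_I_mul (t : ℝ) : jacobiTheta (Complex.I * t) = (theta3 t : ℂ) := by
  rw [jacobiTheta, theta3, Complex.ofReal_tsum]
  refine tsum_congr fun n => ?_
  push_cast
  congr 1
  linear_combination (π * n ^ 2 * t : ℂ) * Complex.I_sq

lemma tendsto_theta3_atTop : Filter.Tendsto theta3 Filter.atTop (nhds 1) := by
  have hlim : Filter.Tendsto (fun t : ℝ => 2 / (1 - Real.exp (-π * t)) * Real.exp (-π * t))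
      Filter.atTop (nhds 0) := by
    have he : Filter.Tendsto (fun t : ℝ => Real.exp (-π * t)) Filter.atTop (nhds 0) :=
      Real.tendsto_exp_atBot.comp
        (Filter.tendsto_id.const_mul_atTop_of_neg (neg_lt_zero.2 Real.pi_pos))
    have := (Filter.Tendsto.div (tendsto_const_nhds (x := (2 : ℝ)))
      (tendsto_const_nhds (x := (1 : ℝ)) |>.sub he) (by norm_num)).mul he
    simpa using this
  rw [tendsto_iff_norm_sub_tendsto_zero]
  refine squeeze_zero' (Filter.Eventually.of_forall fun _ => norm_nonneg _) ?_ hlim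
  filter_upwards [Filter.eventually_gt_atTop 0] with t ht
  have := norm_jacobiTheta_sub_one_le (τ := Complex.I * t) (by simpa using ht)
  rw [jacobiTheta_I_mul, ← Complex.ofReal_one, ← Complex.ofReal_sub, Complex.norm_real] at this
  simpa using this

lemma tendsto_theta4_atTop : Filter.Tendsto theta4 Filter.atTop (nhds 1) := by
  have h4 : Filter.Tendsto (fun t : ℝ => 4 * t) Filter.atTop Filter.atTop :=
    Filter.tendsto_id.const_mul_atTop (by norm_num)
  have := ((tendsto_theta3_atTop.comp h4).const_mul 2).sub tendsto_theta3_atTop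
  norm_num at this
  exact this

/-- The integral evaluating to `π / (2 * agm a b)`. -/
noncomputable def gaussIntegral (a b : ℝ) : ℝ :=
  ∫ θ in (0:ℝ)..(π / 2), (√(a ^ 2 * Real.cos θ ^ 2 + b ^ 2 * Real.sin θ ^ 2))⁻¹

lemma sq_mul_cos_add_sq_mul_sin_pos {a b : ℝ} (ha : 0 < a) (hb : 0 < b) (θ : ℝ) :
    0 < a ^ 2 * Real.cos θ ^ 2 + b ^ 2 * Real.sin θ ^ 2 := by
  by_cases h : Real.cos θ = 0
  · have := Real.sin_sq_add_cos_sq θ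
    simp only [h] at this ⊢
    nlinarith [mul_pos hb hb]
  · have := sq_pos_of_ne_zero h
    positivity

lemma mul_cos_sq_add_mul_sin_sq_pos {a b : ℝ} (ha : 0 < a) (hb : 0 < b) (θ : ℝ) :
    0 < a * Real.cos θ ^ 2 + b * Real.sin θ ^ 2 := by
  simpa [Real.sq_sqrt ha.le, Real.sq_sqrt hb.le] using
    sq_mul_cos_add_sq_mul_sin_pos (Real.sqrt_pos.2 ha) (Real.sqrt_pos.2 hb) θ

lemma continuous_gaussIntegrand {a b : ℝ} (ha : 0 < a) (hb : 0 < b) :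
    Continuous fun θ : ℝ => (√(a ^ 2 * Real.cos θ ^ 2 + b ^ 2 * Real.sin θ ^ 2))⁻¹ := by
  refine Continuous.inv₀ (by fun_prop) fun θ => ?_
  exact (Real.sqrt_pos.2 (sq_mul_cos_add_sq_mul_sin_pos ha hb θ)).ne'

lemma integral_zero_pi_gaussIntegrand {a b : ℝ} (ha : 0 < a) (hb : 0 < b) :
    ∫ θ in (0:ℝ)..π, (√(a ^ 2 * Real.cos θ ^ 2 + b ^ 2 * Real.sin θ ^ 2))⁻¹ =
      2 * gaussIntegral a b := by
  have hc := continuous_gaussIntegrand ha hb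
  rw [← intervalIntegral.integral_add_adjacent_intervals
    (hc.intervalIntegrable 0 (π / 2)) (hc.intervalIntegrable (π / 2) π)]
  have h := intervalIntegral.integral_comp_sub_left (a := 0) (b := π / 2)
    (fun θ : ℝ => (√(a ^ 2 * Real.cos θ ^ 2 + b ^ 2 * Real.sin θ ^ 2))⁻¹) π
  simp only [Real.cos_pi_sub, Real.sin_pi_sub, neg_sq, sub_zero,
    show π - π / 2 = π / 2 by ring] at h
  rw [← h, gaussIntegral]
  ring

/-- The Landen change of variables, written so that it is smooth on the whole line. -/
noncomputable def landenAngle (a b θ : ℝ) : ℝ :=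
  2 * θ - Real.arctan ((a - b) * (Real.sin θ * Real.cos θ) /
    (a * Real.cos θ ^ 2 + b * Real.sin θ ^ 2))

lemma one_add_landen_sq {a b : ℝ} (ha : 0 < a) (hb : 0 < b) (θ : ℝ) :
    1 + ((a - b) * (Real.sin θ * Real.cos θ) /
      (a * Real.cos θ ^ 2 + b * Real.sin θ ^ 2)) ^ 2 =
    (a ^ 2 * Real.cos θ ^ 2 + b ^ 2 * Real.sin θ ^ 2) /
      (a * Real.cos θ ^ 2 + b * Real.sin θ ^ 2) ^ 2 := by
  have h := mul_cos_sq_add_mul_sin_sq_pos ha hb θ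
  have hs := Real.sin_sq_add_cos_sq θ
  rw [div_pow, eq_div_iff (by positivity), add_mul, div_mul_cancel₀ _ (by positivity)]
  linear_combination (a ^ 2 * Real.cos θ ^ 2 + b ^ 2 * Real.sin θ ^ 2) * hs

lemma hasDerivAt_landenAngle {a b : ℝ} (ha : 0 < a) (hb : 0 < b) (θ : ℝ) :
    HasDerivAt (landenAngle a b)
      (1 + a * b / (a ^ 2 * Real.cos θ ^ 2 + b ^ 2 * Real.sin θ ^ 2)) θ := by
  have h := mul_cos_sq_add_mul_sin_sq_pos ha hb θ
  have hD := sq_mul_cos_add_sq_mul_sin_pos ha hb θ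
  have hs := Real.sin_sq_add_cos_sq θ
  have hd := ((hasDerivAt_id θ).const_mul 2).sub
    ((((((Real.hasDerivAt_sin θ).mul (Real.hasDerivAt_cos θ)).const_mul (a - b)).div
      ((((Real.hasDerivAt_cos θ).pow 2).const_mul a).add
        (((Real.hasDerivAt_sin θ).pow 2).const_mul b)) h.ne')).arctan)
  refine HasDerivAt.congr_deriv (f := landenAngle a b) hd ?_
  simp only [Pi.add_apply, Pi.mul_apply, Pi.pow_apply, Pi.div_apply]
  rw [one_add_landen_sq ha hb]
  have hN : (a - b) * (Real.cos θ * Real.cos θ + Real.sin θ * -Real.sin θ) *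
        (a * Real.cos θ ^ 2 + b * Real.sin θ ^ 2) -
      (a - b) * (Real.sin θ * Real.cos θ) *
        (a * (↑2 * Real.cos θ ^ (2 - 1) * -Real.sin θ) +
          b * (↑2 * Real.sin θ ^ (2 - 1) * Real.cos θ)) =
      a ^ 2 * Real.cos θ ^ 2 + b ^ 2 * Real.sin θ ^ 2 - a * b := by
    norm_num
    linear_combination ((a - b) * (a * Real.cos θ ^ 2 - b * Real.sin θ ^ 2) - a * b) * hs
  simp only [Nat.cast_ofNat] at hN ⊢
  rw [hN]
  field_simp
  ring

lemma cos_landenAngle {a b : ℝ} (ha : 0 < a) (hb : 0 < b) (θ : ℝ) :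
    Real.cos (landenAngle a b θ) = (a * Real.cos θ ^ 2 - b * Real.sin θ ^ 2) /
      √(a ^ 2 * Real.cos θ ^ 2 + b ^ 2 * Real.sin θ ^ 2) := by
  have h := mul_cos_sq_add_mul_sin_sq_pos ha hb θ
  have hD := sq_mul_cos_add_sq_mul_sin_pos ha hb θ
  have hDs := Real.sqrt_pos.2 hD
  rw [landenAngle, Real.cos_sub, Real.cos_arctan, Real.sin_arctan, one_add_landen_sq ha hb,
    Real.sqrt_div hD.le, Real.sqrt_sq h.le, Real.cos_two_mul', Real.sin_two_mul,
    one_div_div, div_div_div_cancel_right₀ h.ne']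
  generalize √(a ^ 2 * Real.cos θ ^ 2 + b ^ 2 * Real.sin θ ^ 2) = D at hDs
  field_simp
  linear_combination (a * Real.cos θ ^ 2 - b * Real.sin θ ^ 2) * Real.sin_sq_add_cos_sq θ

lemma sin_landenAngle {a b : ℝ} (ha : 0 < a) (hb : 0 < b) (θ : ℝ) :
    Real.sin (landenAngle a b θ) = (a + b) * (Real.sin θ * Real.cos θ) /
      √(a ^ 2 * Real.cos θ ^ 2 + b ^ 2 * Real.sin θ ^ 2) := by
  have h := mul_cos_sq_add_mul_sin_sq_pos ha hb θ
  have hD := sq_mul_cos_add_sq_mul_sin_pos ha hb θ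
  have hDs := Real.sqrt_pos.2 hD
  rw [landenAngle, Real.sin_sub, Real.cos_arctan, Real.sin_arctan, one_add_landen_sq ha hb,
    Real.sqrt_div hD.le, Real.sqrt_sq h.le, Real.cos_two_mul', Real.sin_two_mul,
    one_div_div, div_div_div_cancel_right₀ h.ne']
  generalize √(a ^ 2 * Real.cos θ ^ 2 + b ^ 2 * Real.sin θ ^ 2) = D at hDs
  field_simp
  linear_combination (a + b) * (Real.sin θ * Real.cos θ) * Real.sin_sq_add_cos_sq θ

lemma sqrt_landenAngle {a b : ℝ} (ha : 0 < a) (hb : 0 < b) (θ : ℝ) :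
    √(((a + b) / 2) ^ 2 * Real.cos (landenAngle a b θ) ^ 2 +
      (√(a * b)) ^ 2 * Real.sin (landenAngle a b θ) ^ 2) =
    (a + b) / 2 * (a * Real.cos θ ^ 2 + b * Real.sin θ ^ 2) /
      √(a ^ 2 * Real.cos θ ^ 2 + b ^ 2 * Real.sin θ ^ 2) := by
  have h := mul_cos_sq_add_mul_sin_sq_pos ha hb θ
  have hD := sq_mul_cos_add_sq_mul_sin_pos ha hb θ
  have hDs := Real.sqrt_pos.2 hD
  rw [Real.sqrt_eq_iff_eq_sq (by positivity) (by positivity), cos_landenAngle ha hb,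
    sin_landenAngle ha hb, Real.sq_sqrt (by positivity)]
  field_simp
  ring

theorem gaussIntegral_landen {a b : ℝ} (ha : 0 < a) (hb : 0 < b) :
    gaussIntegral a b = gaussIntegral ((a + b) / 2) √(a * b) := by
  have ha1 : 0 < (a + b) / 2 := by positivity
  have hb1 : 0 < √(a * b) := Real.sqrt_pos.2 (by positivity)
  have hcv := intervalIntegral.integral_comp_mul_deriv (a := 0) (b := π / 2)
    (fun θ _ => hasDerivAt_landenAngle ha hb θ)
    (Continuous.continuousOn (by
      refine continuous_const.add (continuous_const.div (by fun_prop) fun θ => ?_)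
      exact (sq_mul_cos_add_sq_mul_sin_pos ha hb θ).ne'))
    (continuous_gaussIntegrand ha1 hb1)
  have h0 : landenAngle a b 0 = 0 := by simp [landenAngle]
  have h1 : landenAngle a b (π / 2) = π := by simp [landenAngle]; ring
  rw [h0, h1, integral_zero_pi_gaussIntegrand ha1 hb1] at hcv
  have hint : ∀ θ : ℝ, ((fun θ : ℝ => (√(((a + b) / 2) ^ 2 * Real.cos θ ^ 2 +
      √(a * b) ^ 2 * Real.sin θ ^ 2))⁻¹) ∘ landenAngle a b) θ *
      (1 + a * b / (a ^ 2 * Real.cos θ ^ 2 + b ^ 2 * Real.sin θ ^ 2)) =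
      2 * (√(a ^ 2 * Real.cos θ ^ 2 + b ^ 2 * Real.sin θ ^ 2))⁻¹ := fun θ => by
    have h := mul_cos_sq_add_mul_sin_sq_pos ha hb θ
    have hD := sq_mul_cos_add_sq_mul_sin_pos ha hb θ
    have hDs := Real.sqrt_pos.2 hD
    have hs := Real.sin_sq_add_cos_sq θ
    have hsq := Real.sq_sqrt hD.le
    rw [Function.comp_apply, sqrt_landenAngle ha hb]
    set D := √(a ^ 2 * Real.cos θ ^ 2 + b ^ 2 * Real.sin θ ^ 2)
    rw [← hsq]
    field_simp
    rw [hsq]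
    linear_combination (-a * b) * hs
  simp_rw [hint] at hcv
  rw [intervalIntegral.integral_const_mul] at hcv
  exact mul_left_cancel₀ two_ne_zero hcv

lemma gaussIntegral_mul {l : ℝ} (hl : 0 < l) (a b : ℝ) :
    gaussIntegral (l * a) (l * b) = l⁻¹ * gaussIntegral a b := by
  rw [gaussIntegral, gaussIntegral, ← intervalIntegral.integral_const_mul]
  congr 1 with θ
  rw [show (l * a) ^ 2 * Real.cos θ ^ 2 + (l * b) ^ 2 * Real.sin θ ^ 2 =
    l ^ 2 * (a ^ 2 * Real.cos θ ^ 2 + b ^ 2 * Real.sin θ ^ 2) by ring,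
    Real.sqrt_mul (by positivity), Real.sqrt_sq hl.le, mul_inv]

lemma gaussIntegral_anti {a b a' b' : ℝ} (ha : 0 < a) (hb : 0 < b) (haa : a ≤ a')
    (hbb : b ≤ b') : gaussIntegral a' b' ≤ gaussIntegral a b := by
  refine intervalIntegral.integral_mono (by positivity)
    ((continuous_gaussIntegrand (ha.trans_le haa) (hb.trans_le hbb)).intervalIntegrable _ _)
    ((continuous_gaussIntegrand ha hb).intervalIntegrable _ _) fun θ => ?_
  have := Real.sqrt_pos.2 (sq_mul_cos_add_sq_mul_sin_pos ha hb θ)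
  dsimp only
  gcongr

lemma gaussIntegral_self {a : ℝ} (ha : 0 < a) : gaussIntegral a a = π / 2 / a := by
  have : ∀ θ, a ^ 2 * Real.cos θ ^ 2 + a ^ 2 * Real.sin θ ^ 2 = a ^ 2 := fun θ => by
    linear_combination a ^ 2 * Real.sin_sq_add_cos_sq θ
  simp [gaussIntegral, this, Real.sqrt_sq ha.le, div_eq_mul_inv]

lemma tendsto_gaussIntegral_one {u v : ℕ → ℝ} (hu : ∀ n, 0 < u n) (hv : ∀ n, 0 < v n)
    (hu1 : Filter.Tendsto u Filter.atTop (nhds 1))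
    (hv1 : Filter.Tendsto v Filter.atTop (nhds 1)) :
    Filter.Tendsto (fun n => gaussIntegral (u n) (v n)) Filter.atTop (nhds (π / 2)) := by
  have hmax := (tendsto_const_nhds (x := π / 2)).div (hu1.max hv1) (by simp)
  have hmin := (tendsto_const_nhds (x := π / 2)).div (hu1.min hv1) (by simp)
  simp only [max_self, min_self, div_one] at hmax hmin
  refine tendsto_of_tendsto_of_tendsto_of_le_of_le hmax hmin (fun n => ?_) fun n => ?_
  · simp only [Pi.div_apply]
    rw [← gaussIntegral_self (lt_max_of_lt_left (hu n))]
    exact gaussIntegral_anti (hu n) (hv n) (le_max_left _ _) (le_max_right _ _)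
  · simp only [Pi.div_apply]
    have hm := lt_min (hu n) (hv n)
    rw [← gaussIntegral_self hm]
    exact gaussIntegral_anti hm hm (min_le_left _ _) (min_le_right _ _)

lemma ellK_eq_gaussIntegral {x : ℝ} (hx0 : 0 ≤ x) (hx1 : x ≤ 1) :
    ellK x = gaussIntegral 1 √(1 - x ^ 2) := by
  rw [ellK, gaussIntegral]
  congr 1 with θ
  have hx : 0 ≤ 1 - x ^ 2 := by nlinarith
  have h : 1 - x ^ 2 * Real.sin θ ^ 2 =
      1 ^ 2 * Real.cos θ ^ 2 + √(1 - x ^ 2) ^ 2 * Real.sin θ ^ 2 := by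
    rw [Real.sq_sqrt hx]
    linear_combination -Real.sin_sq_add_cos_sq θ
  rw [← h, neg_div, Real.rpow_neg (by rw [h]; positivity), Real.sqrt_eq_rpow]

lemma ellK_lt_ellK {x y : ℝ} (hx : 0 ≤ x) (hxy : x < y) (hy : y < 1) : ellK x < ellK y := by
  have hsx : 0 < 1 - x ^ 2 := by nlinarith
  have hsy : 0 < 1 - y ^ 2 := by nlinarith
  rw [ellK_eq_gaussIntegral hx (hxy.trans hy).le, ellK_eq_gaussIntegral (hx.trans hxy.le) hy.le]
  refine intervalIntegral.integral_lt_integral_of_continuousOn_of_le_of_exists_lt (by positivity)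
    (continuous_gaussIntegrand one_pos (Real.sqrt_pos.2 hsx)).continuousOn
    (continuous_gaussIntegrand one_pos (Real.sqrt_pos.2 hsy)).continuousOn (fun θ _ => ?_)
    ⟨π / 2, Set.right_mem_Icc.2 (by positivity), ?_⟩
  · have := Real.sqrt_pos.2
      (sq_mul_cos_add_sq_mul_sin_pos one_pos (Real.sqrt_pos.2 hsy) θ)
    gcongr
  · simp only [Real.cos_pi_div_two, Real.sin_pi_div_two]
    have := Real.sqrt_pos.2 hsy
    norm_num
    gcongr

lemma gaussIntegral_theta {t : ℝ} (ht : 0 < t) :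
    gaussIntegral (theta3 t ^ 2) (theta4 t ^ 2) = π / 2 := by
  have hstep : ∀ t : ℝ, 0 < t → gaussIntegral (theta3 t ^ 2) (theta4 t ^ 2) =
      gaussIntegral (theta3 (2 * t) ^ 2) (theta4 (2 * t) ^ 2) := fun t ht => by
    have h3 := theta3_pos ht
    have h4 := theta4_pos ht
    rw [gaussIntegral_landen (by positivity) (by positivity), theta3_sq_add_theta4_sq ht,
      ← mul_pow, Real.sqrt_sq (by positivity), theta3_mul_theta4 ht]
  have hiter : ∀ n : ℕ, gaussIntegral (theta3 t ^ 2) (theta4 t ^ 2) =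
      gaussIntegral (theta3 (2 ^ n * t) ^ 2) (theta4 (2 ^ n * t) ^ 2) := fun n => by
    induction n with
    | zero => simp
    | succ n ih => rw [ih, hstep _ (by positivity), ← mul_assoc, ← pow_succ']
  have hlim : Filter.Tendsto (fun n : ℕ => (2 : ℝ) ^ n * t) Filter.atTop Filter.atTop :=
    (tendsto_pow_atTop_atTop_of_one_lt one_lt_two).atTop_mul_const ht
  have h3 := (tendsto_theta3_atTop.comp hlim).pow 2
  have h4 := (tendsto_theta4_atTop.comp hlim).pow 2
  rw [one_pow] at h3 h4
  have h := tendsto_gaussIntegral_one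
    (fun n => pow_pos (theta3_pos (by positivity)) 2)
    (fun n => pow_pos (theta4_pos (by positivity)) 2) h3 h4
  exact tendsto_nhds_unique (tendsto_const_nhds.congr hiter) h

/-- The elliptic modulus at the nome `exp (-π t)`. -/
noncomputable def thetaModulus (t : ℝ) : ℝ := theta2 t ^ 2 / theta3 t ^ 2

lemma thetaModulus_pos {t : ℝ} (ht : 0 < t) : 0 < thetaModulus t :=
  div_pos (pow_pos (theta2_pos ht) 2) (pow_pos (theta3_pos ht) 2)

lemma thetaModulus_inv {t : ℝ} (ht : 0 < t) :
    thetaModulus t⁻¹ = theta4 t ^ 2 / theta3 t ^ 2 := by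
  have := Real.sqrt_pos.2 ht
  rw [thetaModulus, theta2_inv ht, theta3_inv ht, mul_pow, mul_pow,
    mul_div_mul_left _ _ (by positivity)]

lemma sqrt_one_sub_thetaModulus_sq {t : ℝ} (ht : 0 < t) :
    √(1 - thetaModulus t ^ 2) = thetaModulus t⁻¹ := by
  have h3 := theta3_pos ht
  rw [Real.sqrt_eq_iff_mul_self_eq_of_pos (thetaModulus_pos (inv_pos.2 ht)), thetaModulus_inv ht,
    thetaModulus]
  field_simp
  linear_combination theta3_pow_four ht

lemma thetaModulus_lt_one {t : ℝ} (ht : 0 < t) : thetaModulus t < 1 := by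
  have h3 := theta3_pos ht
  have h4 := pow_pos (theta4_pos ht) 4
  rw [thetaModulus, div_lt_one (by positivity)]
  refine lt_of_pow_lt_pow_left₀ 2 (by positivity) ?_
  linarith [theta3_pow_four ht]

lemma ellK_thetaModulus {t : ℝ} (ht : 0 < t) :
    ellK (thetaModulus t) = π / 2 * theta3 t ^ 2 := by
  have h3 := theta3_pos ht
  rw [ellK_eq_gaussIntegral (thetaModulus_pos ht).le (thetaModulus_lt_one ht).le,
    sqrt_one_sub_thetaModulus_sq ht, thetaModulus_inv ht, ← gaussIntegral_theta ht]
  have h := gaussIntegral_mul (l := theta3 t ^ 2) (by positivity) 1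
    (theta4 t ^ 2 / theta3 t ^ 2)
  rw [mul_one, mul_div_cancel₀ _ (by positivity)] at h
  rw [h]
  field_simp

lemma ellK_sqrt_one_sub_thetaModulus_sq {t : ℝ} (ht : 0 < t) :
    ellK √(1 - thetaModulus t ^ 2) = t * ellK (thetaModulus t) := by
  rw [sqrt_one_sub_thetaModulus_sq ht, ellK_thetaModulus (inv_pos.2 ht), ellK_thetaModulus ht,
    theta3_inv ht, mul_pow, Real.sq_sqrt ht.le]
  ring

lemma eq_of_ellK_ratio_eq {t x y : ℝ} (ht : 0 < t) (hx0 : 0 < x) (hx1 : x < 1) (hy0 : 0 < y)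
    (hy1 : y < 1) (hx : ellK √(1 - x ^ 2) = t * ellK x) (hy : ellK √(1 - y ^ 2) = t * ellK y) :
    x = y := by
  have key : ∀ x y : ℝ, 0 < x → x < y → y < 1 → ellK √(1 - x ^ 2) = t * ellK x →
      ellK √(1 - y ^ 2) = t * ellK y → False := fun x y hx0 hxy hy1 hx hy => by
    have h1 := mul_lt_mul_of_pos_left (ellK_lt_ellK hx0.le hxy hy1) ht
    have h2 := ellK_lt_ellK (Real.sqrt_nonneg (1 - y ^ 2))
      (Real.sqrt_lt_sqrt (by nlinarith) (show 1 - y ^ 2 < 1 - x ^ 2 by nlinarith))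
      ((Real.sqrt_lt' one_pos).2 (by nlinarith))
    linarith
  rcases lt_trichotomy x y with h | h | h
  · exact (key x y hx0 h hy1 hx hy).elim
  · exact h
  · exact (key y x hy0 h hx1 hy hx).elim

lemma tsum_rpow_eq_theta2 (t : ℝ) (s : ℤ) :
    ∑' n : ℤ, Real.exp (-π * t) ^ ((n : ℝ) ^ 2 + (2 * (s : ℝ) + 1) * (n : ℝ)) =
      Real.exp (-π * t) ^ (-(2 * (s : ℝ) + 1) ^ 2 / 4) * theta2 t := by
  rw [theta2, ← (Equiv.subRight s).tsum_eq, ← tsum_mul_left]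
  refine tsum_congr fun n => ?_
  rw [← Real.exp_mul, ← Real.exp_mul, ← Real.exp_add]
  congr 1
  simp only [Equiv.subRight_apply]
  push_cast
  ring

lemma landen_modulus_identity {k k' l l' : ℝ} (hk0 : 0 < k) (hk1 : k < 1)
    (hk' : k' = √(1 - k ^ 2)) (hl : l = (2 - k ^ 2 - 2 * k') / k ^ 2) (hl' : l' = √(1 - l ^ 2)) :
    2 ^ ((5 : ℝ) / 6) * (k * k' * l) ^ ((1 : ℝ) / 6) * l' ^ (-(1 : ℝ) / 3) = √(2 * k) := by
  have hk2 : 0 < 1 - k ^ 2 := by nlinarith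
  have hk0' : 0 < k' := hk' ▸ Real.sqrt_pos.2 hk2
  have hsq : k' ^ 2 = 1 - k ^ 2 := hk' ▸ Real.sq_sqrt hk2.le
  have hk1' : k' < 1 := by nlinarith
  have hl2 : l = (1 - k') / (1 + k') := by
    rw [hl, div_eq_div_iff (by positivity) (by positivity)]
    linear_combination -2 * hsq
  have hl0 : 0 < l := hl2 ▸ div_pos (by linarith) (by linarith)
  have hl_sub' : 1 - l ^ 2 = 4 * k' / (1 + k') ^ 2 := by
    rw [hl2]
    field_simp
    ring
  have hl0' : 0 < l' := by
    rw [hl', hl_sub']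
    positivity
  have hl_sq' : l' ^ 2 = 4 * k' / (1 + k') ^ 2 := by
    rw [hl', Real.sq_sqrt (by rw [hl_sub']; positivity), hl_sub']
  have hid : 2 ^ 5 * (k * k' * l) = (2 * k) ^ 3 * l' ^ 2 := by
    rw [hl_sq', hl2]
    field_simp
    linear_combination -4 * hsq
  have e1 : (2 : ℝ) ^ ((5 : ℝ) / 6) = ((2 : ℝ) ^ 5) ^ ((1 : ℝ) / 6) := by
    rw [← Real.rpow_natCast, ← Real.rpow_mul (by norm_num)]
    norm_num
  rw [e1, ← Real.mul_rpow (by positivity) (by positivity), hid,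
    Real.mul_rpow (by positivity) (by positivity), ← Real.rpow_natCast, ← Real.rpow_natCast,
    ← Real.rpow_mul (by positivity), ← Real.rpow_mul hl0'.le, mul_assoc, ← Real.rpow_add hl0',
    Real.sqrt_eq_rpow]
  norm_num
theorem stmt2 (r : ℝ) (hr : 0 < r) (q : ℝ) (hq : q = Real.exp (-π * Real.sqrt r))
    (k₁₁ : ℝ) (hk0 : 0 < k₁₁) (hk1 : k₁₁ < 1)
    (hk : ellK (Real.sqrt (1 - k₁₁ ^ 2)) = Real.sqrt r * ellK k₁₁)
    (k₁₂ k₂₁ k₂₂ : ℝ)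
    (h12 : k₁₂ = Real.sqrt (1 - k₁₁ ^ 2))
    (h21 : k₂₁ = (2 - k₁₁ ^ 2 - 2 * k₁₂) / k₁₁ ^ 2)
    (h22 : k₂₂ = Real.sqrt (1 - k₂₁ ^ 2)) (s : ℤ) :
    ∑' n : ℤ, q ^ ((n : ℝ) ^ 2 + (2 * (s : ℝ) + 1) * (n : ℝ)) =
      2 ^ ((5 : ℝ) / 6) * q ^ (-(2 * (s : ℝ) + 1) ^ 2 / 4) *
        (k₁₁ * k₁₂ * k₂₁) ^ ((1 : ℝ) / 6) * k₂₂ ^ (-(1 : ℝ) / 3) *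
        Real.sqrt (ellK k₁₁ / π) := by

  have ht := Real.sqrt_pos.2 hr
  obtain rfl : k₁₁ = thetaModulus √r := eq_of_ellK_ratio_eq ht hk0 hk1 (thetaModulus_pos ht)
    (thetaModulus_lt_one ht) hk (ellK_sqrt_one_sub_thetaModulus_sq ht)
  have h2 := theta2_pos ht
  have h3 := theta3_pos ht
  have hroot : √(2 * thetaModulus √r) * √(ellK (thetaModulus √r) / π) = theta2 √r := by
    rw [← Real.sqrt_mul (by positivity), ellK_thetaModulus ht, thetaModulus,
      Real.sqrt_eq_iff_eq_sq (by positivity) h2.le]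
    field_simp
  rw [hq, tsum_rpow_eq_theta2, ← hroot, ← landen_modulus_identity hk0 hk1 h12 h21 h22]
  ring
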